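/- Let T be a finite-dimensional real vector space, F ⊆ T a subspace, and L ⊆ T × T* a maximal isotropic subspace for the canonical symmetric form. Then T = H(L, F) ⊕ F (i.e. L is F-coupling) if and only if L ∩ (F × ann F) = {(0, 0)}. -/

import Mathlib

/-- The canonical symmetric pairing `g((X,α),(Y,β)) = (1/2)(β(X) + α(Y))` on `T × T*`. -/
noncomputable def cpair {T : Type*} [AddCommGroup T] [Module ℝ T]
    (p q : T × Module.Dual ℝ T) : ℝ :=
  (1/2 : ℝ) * (q.2 p.1 + p.2 q.1)

/-- A subspace of `T × T*` is isotropic if the canonical pairing vanishes on it. -/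
def IsIsotropic {T : Type*} [AddCommGroup T] [Module ℝ T]
    (L : Submodule ℝ (T × Module.Dual ℝ T)) : Prop :=
  ∀ p ∈ L, ∀ q ∈ L, cpair p q = 0

/-- `H(L, F) = {Z : ∃ α ∈ ann F, (Z, α) ∈ L}`. -/
def couplingH {T : Type*} [AddCommGroup T] [Module ℝ T]
    (L : Submodule ℝ (T × Module.Dual ℝ T)) (F : Submodule ℝ T) : Submodule ℝ T :=
  Submodule.map (LinearMap.fst ℝ T (Module.Dual ℝ T))
    (L ⊓ Submodule.prod ⊤ F.dualAnnihilator)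

/-- A null vector orthogonal to a maximal isotropic subspace lies in it. -/
theorem mem_of_forall_cpair_eq_zero {T : Type*} [AddCommGroup T] [Module ℝ T]
    {L : Submodule ℝ (T × Module.Dual ℝ T)} (hiso : IsIsotropic L)
    (hmax : ∀ L' : Submodule ℝ (T × Module.Dual ℝ T), IsIsotropic L' → L ≤ L' → L' = L)
    {v : T × Module.Dual ℝ T} (hv : cpair v v = 0) (hvL : ∀ p ∈ L, cpair v p = 0) :
    v ∈ L := by
  have h : L ⊔ Submodule.span ℝ {v} = L := by
    refine hmax _ ?_ le_sup_left
    intro p hp q hq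
    obtain ⟨x, hx, y, hy, rfl⟩ := Submodule.mem_sup.1 hp
    obtain ⟨z, hz, w, hw, rfl⟩ := Submodule.mem_sup.1 hq
    obtain ⟨a, rfl⟩ := Submodule.mem_span_singleton.1 hy
    obtain ⟨b, rfl⟩ := Submodule.mem_span_singleton.1 hw
    have hxz := hiso x hx z hz
    have hvx := hvL x hx
    have hvz := hvL z hz
    simp only [cpair, Prod.fst_add, Prod.snd_add, Prod.smul_fst, Prod.smul_snd, map_add, map_smul,
      LinearMap.add_apply, LinearMap.smul_apply, smul_eq_mul] at *
    linear_combination hxz + b * hvx + a * hvz + a * b * hv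
  rw [← h]
  exact Submodule.mem_sup_right (Submodule.mem_span_singleton_self v)

/-- Every linear functional on `T × T*` is twice the canonical pairing with some vector. -/
theorem exists_forall_eq_two_mul_cpair {T : Type*} [AddCommGroup T] [Module ℝ T]
    [FiniteDimensional ℝ T] (φ : Module.Dual ℝ (T × Module.Dual ℝ T)) :
    ∃ v, ∀ p, φ p = 2 * cpair v p := by
  obtain ⟨X, hX⟩ := (Module.evalEquiv ℝ T).surjective
    (φ ∘ₗ LinearMap.inr ℝ T (Module.Dual ℝ T))
  refine ⟨(X, φ ∘ₗ LinearMap.inl ℝ T (Module.Dual ℝ T)), fun p => ?_⟩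
  have h := LinearMap.congr_fun hX p.2
  simp only [Module.evalEquiv_apply, Module.Dual.eval_apply, LinearMap.comp_apply,
    LinearMap.inr_apply] at h
  have hp : φ p = φ (p.1, 0) + φ (0, p.2) := by simp [← map_add]
  simp only [cpair, LinearMap.comp_apply, LinearMap.inl_apply]
  rw [hp, ← h]
  ring

/-- A maximal isotropic subspace that meets `F × ann F` trivially spans `T × T*` with it. -/
theorem sup_prod_dualAnnihilator_eq_top {T : Type*} [AddCommGroup T] [Module ℝ T]
    [FiniteDimensional ℝ T] {F : Submodule ℝ T} {L : Submodule ℝ (T × Module.Dual ℝ T)}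
    (hiso : IsIsotropic L)
    (hmax : ∀ L' : Submodule ℝ (T × Module.Dual ℝ T), IsIsotropic L' → L ≤ L' → L' = L)
    (h : L ⊓ F.prod F.dualAnnihilator = ⊥) : L ⊔ F.prod F.dualAnnihilator = ⊤ := by
  rw [← Subspace.dualAnnihilator_inj, Submodule.dualAnnihilator_top, eq_bot_iff]
  intro φ hφ
  rw [Submodule.mem_dualAnnihilator] at hφ
  obtain ⟨v, hv⟩ := exists_forall_eq_two_mul_cpair φ
  have hpair : ∀ p ∈ L ⊔ F.prod F.dualAnnihilator, cpair v p = 0 := fun p hp => by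
    linarith [hφ p hp, hv p]
  have hv1 : v.1 ∈ F := by
    rw [← Subspace.dualAnnihilator_dualCoannihilator_eq (W := F), Submodule.mem_dualCoannihilator]
    intro β hβ
    simpa [cpair] using hpair (0, β) (Submodule.mem_sup_right ⟨F.zero_mem, hβ⟩)
  have hv2 : v.2 ∈ F.dualAnnihilator := by
    rw [Submodule.mem_dualAnnihilator]
    intro Y hY
    simpa [cpair] using hpair (Y, 0) (Submodule.mem_sup_right ⟨hY, Submodule.zero_mem _⟩)
  have hvM : v ∈ F.prod F.dualAnnihilator := ⟨hv1, hv2⟩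
  have hvL : v ∈ L := mem_of_forall_cpair_eq_zero hiso hmax
    (hpair v (Submodule.mem_sup_right hvM)) fun p hp => hpair p (Submodule.mem_sup_left hp)
  have hv0 : v = 0 := (Submodule.mem_bot ℝ).1 (h ▸ Submodule.mem_inf.2 ⟨hvL, hvM⟩)
  rw [Submodule.mem_bot]
  refine LinearMap.ext fun p => ?_
  simp [hv, hv0, cpair]

theorem mem_couplingH {T : Type*} [AddCommGroup T] [Module ℝ T]
    {L : Submodule ℝ (T × Module.Dual ℝ T)} {F : Submodule ℝ T} {Z : T} :
    Z ∈ couplingH L F ↔ ∃ α ∈ F.dualAnnihilator, (Z, α) ∈ L := by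
  simp [couplingH, Submodule.mem_map, and_comm]

/-- A maximal isotropic `L ⊆ T × T*` is `F`-coupling, i.e.
`T = H(L, F) ⊕ F`, iff `L ∩ (F × ann F) = {(0, 0)}`. -/
theorem stmt15 {T : Type*} [AddCommGroup T] [Module ℝ T] [FiniteDimensional ℝ T]
    (F : Submodule ℝ T)
    (L : Submodule ℝ (T × Module.Dual ℝ T))
    (hiso : IsIsotropic L)
    (hmax : ∀ L' : Submodule ℝ (T × Module.Dual ℝ T), IsIsotropic L' → L ≤ L' → L' = L) :
    IsCompl (couplingH L F) F ↔ L ⊓ F.prod F.dualAnnihilator = ⊥ := by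
  constructor
  · intro hc
    rw [eq_bot_iff]
    rintro ⟨X, α⟩ ⟨hL, hX, hα⟩
    obtain rfl : X = 0 :=
      Submodule.disjoint_def.1 hc.disjoint X (mem_couplingH.2 ⟨α, hα, hL⟩) hX
    have hα0 : α = 0 := by
      refine LinearMap.ext fun Z => ?_
      obtain ⟨Y, hY, W, hW, rfl⟩ :=
        Submodule.mem_sup.1 (hc.sup_eq_top ▸ Submodule.mem_top (x := Z))
      obtain ⟨β, -, hβ⟩ := mem_couplingH.1 hY
      have hαY : α Y = 0 := by simpa [cpair] using hiso _ hL _ hβ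
      have hαW : α W = 0 := (Submodule.mem_dualAnnihilator α).1 hα W hW
      simp [hαY, hαW]
    simp [hα0]
  · intro h
    refine ⟨Submodule.disjoint_def.2 fun Z hZ hF => ?_, codisjoint_iff.2 ?_⟩
    · obtain ⟨α, hα, hL⟩ := mem_couplingH.1 hZ
      have h0 : (Z, α) = 0 :=
        (Submodule.mem_bot ℝ).1 (h ▸ Submodule.mem_inf.2 ⟨hL, hF, hα⟩)
      exact congrArg Prod.fst h0
    · rw [eq_top_iff]
      intro Z _
      obtain ⟨⟨Y, β⟩, hL, ⟨W, γ⟩, ⟨hW, hγ⟩, hsum⟩ := Submodule.mem_sup.1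
        (sup_prod_dualAnnihilator_eq_top hiso hmax h ▸
          Submodule.mem_top (x := ((Z, 0) : T × Module.Dual ℝ T)))
      obtain ⟨hYW, hβγ⟩ := Prod.mk.inj hsum
      refine Submodule.mem_sup.2 ⟨Y, mem_couplingH.2 ⟨β, ?_, hL⟩, W, hW, hYW⟩
      rw [show β = -γ from eq_neg_of_add_eq_zero_left hβγ]
      exact Submodule.neg_mem _ hγ
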